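/- arXiv:1809.00134 — 4 statements merged into one kernel-verified Lean document; each statement's English description precedes it below -/
import Mathlib

section
/- Let C be an EL concept and T an EL TBox, and let I_{T,C} be the finite canonical model of T and C. Then: (1) I_{T,C} is a model of T; (2) for all D₀ ∈ sub(T,C) with a_{D₀} ∈ Δ^{I_{T,C}} and all EL concepts D₁: T ⊨ D₀ ⊑ D₁ iff a_{D₀} ∈ D₁^{I_{T,C}}. -/
namespace DL

/-- Roles: role names or inverse roles.  Role names are natural numbers. -/
inductive Role : Type
  | nm (r : ℕ) : Role
  | inv (r : ℕ) : Role
  deriving DecidableEq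

/-- The inverse of a role. -/
def Role.flip : Role → Role
  | .nm r => .inv r
  | .inv r => .nm r

/-- The role name occurring in a role. -/
def Role.name : Role → ℕ
  | .nm r => r
  | .inv r => r

/-- Interpretations.  Concept names, role names, and individual names are natural
numbers.  The standard name assumption is modelled by a partial, injective
interpretation `ind` of individual names: `ind a = some d` means that the individual
name `a` belongs to the domain and is (identified with) the element `d`. -/
structure Interp : Type 1 where
  Dom : Type
  dne : Nonempty Dom
  ind : ℕ → Option Dom
  ind_inj : ∀ a b d, ind a = some d → ind b = some d → a = b
  cInt : ℕ → Set Dom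
  rInt : ℕ → Set (Dom × Dom)

/-- Extension of a (possibly inverse) role. -/
def Interp.rI (I : Interp) : Role → Set (I.Dom × I.Dom)
  | .nm r => I.rInt r
  | .inv r => {p | (p.2, p.1) ∈ I.rInt r}

/-- ABoxes: sets of concept assertions `(A, a)` and role assertions `(r, a, b)`. -/
structure ABox : Type where
  ca : Set (ℕ × ℕ)
  ra : Set (ℕ × ℕ × ℕ)

/-- The individual names occurring in an ABox. -/
def ABox.ind (A : ABox) : Set ℕ :=
  {a | (∃ p ∈ A.ca, p.2 = a) ∨ (∃ t ∈ A.ra, t.2.1 = a ∨ t.2.2 = a)}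

/-- The ABox is finite. -/
def ABox.Fin (A : ABox) : Prop := A.ca.Finite ∧ A.ra.Finite

/-- The ABox only uses concept names from `Sc` and role names from `Sr`
(i.e. it is a `S`-ABox for the signature `S = Sc ∪ Sr`). -/
def ABox.usesOnly (A : ABox) (Sc Sr : Set ℕ) : Prop :=
  (∀ p ∈ A.ca, p.1 ∈ Sc) ∧ (∀ t ∈ A.ra, t.1 ∈ Sr)

/-- `I` is a model of the ABox `A` (under the standard name assumption). -/
def Interp.modelA (I : Interp) (A : ABox) : Prop :=
  (∀ p ∈ A.ca, ∃ d, I.ind p.2 = some d ∧ d ∈ I.cInt p.1) ∧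
  (∀ t ∈ A.ra, ∃ d e, I.ind t.2.1 = some d ∧ I.ind t.2.2 = some e ∧ (d, e) ∈ I.rInt t.1)

/-- `I` respects the closed predicates `Sc` (concept names) and `Sr` (role names)
with respect to the ABox `A`: the extension of each closed predicate is exactly
what is asserted in `A`. -/
def Interp.respects (I : Interp) (A : ABox) (Sc Sr : Set ℕ) : Prop :=
  (∀ B ∈ Sc, ∀ d, d ∈ I.cInt B ↔ ∃ a, I.ind a = some d ∧ (B, a) ∈ A.ca) ∧
  (∀ r ∈ Sr, ∀ d e, (d, e) ∈ I.rInt r ↔ ∃ a b, I.ind a = some d ∧ I.ind b = some e ∧ (r, a, b) ∈ A.ra)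

/-- First-order queries built from concept atoms, role atoms and equality using
negation, conjunction, disjunction and existential quantification.
Variables are natural numbers. -/
inductive FO : Type
  | eq (x y : ℕ)
  | capp (B x : ℕ)
  | rapp (r x y : ℕ)
  | neg (φ : FO)
  | conj (φ ψ : FO)
  | disj (φ ψ : FO)
  | ex (x : ℕ) (φ : FO)

/-- Standard first-order evaluation of a query in an interpretation under an
assignment. -/
def Interp.evalFO (I : Interp) : (ℕ → I.Dom) → FO → Prop
  | v, .eq x y => v x = v y
  | v, .capp B x => v x ∈ I.cInt B
  | v, .rapp r x y => (v x, v y) ∈ I.rInt r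
  | v, .neg φ => ¬ I.evalFO v φ
  | v, .conj φ ψ => I.evalFO v φ ∧ I.evalFO v ψ
  | v, .disj φ ψ => I.evalFO v φ ∨ I.evalFO v ψ
  | v, .ex x φ => ∃ d : I.Dom, I.evalFO (Function.update v x d) φ

/-- Free variables of a first-order query. -/
def FO.free : FO → Set ℕ
  | .eq x y => {x, y}
  | .capp _ x => {x}
  | .rapp _ x y => {x, y}
  | .neg φ => φ.free
  | .conj φ ψ => φ.free ∪ ψ.free
  | .disj φ ψ => φ.free ∪ ψ.free
  | .ex x φ => φ.free \ {x}

/-- Conjunctions of concept and role atoms. -/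
inductive IsConjAtoms : FO → Prop
  | capp (B x : ℕ) : IsConjAtoms (.capp B x)
  | rapp (r x y : ℕ) : IsConjAtoms (.rapp r x y)
  | conj {φ ψ : FO} : IsConjAtoms φ → IsConjAtoms ψ → IsConjAtoms (.conj φ ψ)

/-- Conjunctive queries: existentially quantified conjunctions of atoms. -/
inductive IsCQ : FO → Prop
  | base {φ : FO} : IsConjAtoms φ → IsCQ φ
  | ex {φ : FO} (x : ℕ) : IsCQ φ → IsCQ (.ex x φ)

/-- Unions of conjunctive queries: disjunctions of CQs. -/
inductive IsUCQ : FO → Prop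
  | base {φ : FO} : IsCQ φ → IsUCQ φ
  | disj {φ ψ : FO} : IsUCQ φ → IsUCQ ψ → IsUCQ (.disj φ ψ)

/-- `v` maps the answer variables `xs` to (the domain elements named by) the
individual names `as`. -/
def matches' (I : Interp) (xs as : List ℕ) (v : ℕ → I.Dom) : Prop :=
  ∀ p ∈ List.zip xs as, I.ind p.2 = some (v p.1)

/-- `I ⊨ q(as)`, where `xs` is the list of answer variables of `q`. -/
def Interp.sat (I : Interp) (q : FO) (xs as : List ℕ) : Prop :=
  ∃ v : ℕ → I.Dom, matches' I xs as v ∧ I.evalFO v q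

/-- Certain answers of the ontology-mediated query with closed predicates
`(T, Σ_C, q)` where the models of the TBox `T` are given by the predicate `mod`:
`as` is a certain answer to `q` (with answer variables `xs`) over `A` iff every
model of the TBox and `A` that respects the closed predicates satisfies `q(as)`. -/
def certAns (mod : Interp → Prop) (Sc Sr : Set ℕ) (A : ABox) (q : FO) (xs as : List ℕ) : Prop :=
  ∀ I : Interp, mod I → I.modelA A → I.respects A Sc Sr → I.sat q xs as

/-- `A` is consistent w.r.t. the TBox (given by `mod`) and the closed predicates. -/
def consistentW (mod : Interp → Prop) (Sc Sr : Set ℕ) (A : ABox) : Prop :=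
  ∃ I : Interp, mod I ∧ I.modelA A ∧ I.respects A Sc Sr

/-- EL concepts. -/
inductive EL : Type
  | atom (B : ℕ)
  | top
  | conj (C D : EL)
  | ex (r : ℕ) (C : EL)
  deriving DecidableEq

/-- Semantics of EL concepts. -/
def Interp.semE (I : Interp) : EL → Set I.Dom
  | .atom B => I.cInt B
  | .top => Set.univ
  | .conj C D => I.semE C ∩ I.semE D
  | .ex r C => {d | ∃ e, (d, e) ∈ I.rInt r ∧ e ∈ I.semE C}

/-- An EL TBox is a finite list of concept inclusions `C ⊑ D`. -/
abbrev ELTBox := List (EL × EL)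

/-- `I` is a model of the EL TBox `T`. -/
def Interp.modelEL (I : Interp) (T : ELTBox) : Prop :=
  ∀ p ∈ T, I.semE p.1 ⊆ I.semE p.2

/-- `T ⊨ C ⊑ D` for EL concepts. -/
def elEnt (T : ELTBox) (C D : EL) : Prop :=
  ∀ I : Interp, I.modelEL T → I.semE C ⊆ I.semE D

/-- Concept names occurring in an EL concept. -/
def EL.sigC : EL → Set ℕ
  | .atom B => {B}
  | .top => ∅
  | .conj C D => C.sigC ∪ D.sigC
  | .ex _ C => C.sigC

/-- Role names occurring in an EL concept. -/
def EL.sigR : EL → Set ℕ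
  | .atom _ => ∅
  | .top => ∅
  | .conj C D => C.sigR ∪ D.sigR
  | .ex r C => insert r C.sigR

/-- `E.isTlc C` : `E` is a top-level conjunct of `C`. -/
def EL.isTlc : EL → EL → Prop
  | E, .conj C D => E = .conj C D ∨ E.isTlc C ∨ E.isTlc D
  | E, C => E = C

/-- Subconcepts of an EL concept (including the concept itself). -/
def EL.subs : EL → Set EL
  | .atom B => {.atom B}
  | .top => {.top}
  | .conj C D => insert (.conj C D) (C.subs ∪ D.subs)
  | .ex r C => insert (.ex r C) C.subs

/-- `sub(T)`: subconcepts of concepts occurring in the EL TBox `T`. -/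
def elSubsT (T : ELTBox) : Set EL :=
  {E | ∃ p ∈ T, E ∈ p.1.subs ∪ p.2.subs}

/-- Concept names occurring in an EL TBox. -/
def elTSigC (T : ELTBox) : Set ℕ :=
  {B | ∃ p ∈ T, B ∈ p.1.sigC ∪ p.2.sigC}

/-- Role names occurring in an EL TBox. -/
def elTSigR (T : ELTBox) : Set ℕ :=
  {r | ∃ p ∈ T, r ∈ p.1.sigR ∪ p.2.sigR}

/-- `sub(T, C)`: subconcepts of `C` and of the concepts occurring in `T`. -/
def elSubsTC (T : ELTBox) (C : EL) : Set EL := elSubsT T ∪ C.subs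

/-- The domain of the finite canonical model `I_{T,C}`: it consists of `a_C` and
of `a_{C'}` for every `∃r.C' ∈ sub(T, C)` (the element `a_D` is represented by
the concept `D` itself). -/
def canDom (T : ELTBox) (C : EL) : Set EL :=
  insert C {C' | ∃ r : ℕ, EL.ex r C' ∈ elSubsTC T C}

/-- The finite canonical model `I_{T,C}` of the EL TBox `T` and EL concept `C`:
* `a_D ∈ A^{I_{T,C}}` iff `T ⊨ D ⊑ A`;
* `(a_{D₀}, a_{D₁}) ∈ r^{I_{T,C}}` iff `T ⊨ D₀ ⊑ ∃r.D₁` and (`∃r.D₁ ∈ sub(T)` or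
  `∃r.D₁` is a top-level conjunct of `D₀`).
It interprets no individual names. -/
def canModel (T : ELTBox) (C : EL) : Interp where
  Dom := {D : EL // D ∈ canDom T C}
  dne := ⟨⟨C, Set.mem_insert C _⟩⟩
  ind := fun _ => none
  ind_inj := by intro a b d h; simp at h
  cInt := fun B => {d | elEnt T d.1 (.atom B)}
  rInt := fun r => {p | elEnt T p.1.1 (.ex r p.2.1) ∧
    (EL.ex r p.2.1 ∈ elSubsT T ∨ EL.isTlc (.ex r p.2.1) p.1.1)}

theorem EL.isTlc_refl (C : EL) : C.isTlc C := by
  cases C <;> simp [EL.isTlc]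

theorem EL.mem_subs_self (C : EL) : C ∈ C.subs := by
  cases C <;> simp [EL.subs]

theorem EL.isTlc.mem_subs {E : EL} : ∀ {D : EL}, E.isTlc D → E ∈ D.subs
  | .atom B, h => by simpa [EL.isTlc, EL.subs] using h
  | .top, h => by simpa [EL.isTlc, EL.subs] using h
  | .ex r D, h => by
    have h' : E = .ex r D := by simpa [EL.isTlc] using h
    exact Or.inl h'
  | .conj D₁ D₂, h => by
    rcases h with h | h | h
    · exact Or.inl h
    · exact Or.inr (Or.inl h.mem_subs)
    · exact Or.inr (Or.inr h.mem_subs)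

/-- Both parts of a conjunction that is a top-level conjunct are top-level conjuncts. -/
theorem EL.isTlc.of_conj {E F : EL} :
    ∀ {D : EL}, (EL.conj E F).isTlc D → E.isTlc D ∧ F.isTlc D
  | .atom B, h => by simp [EL.isTlc] at h
  | .top, h => by simp [EL.isTlc] at h
  | .ex r D, h => by simp [EL.isTlc] at h
  | .conj D₁ D₂, h => by
    rcases h with h | h | h
    · cases h
      exact ⟨Or.inr (Or.inl E.isTlc_refl), Or.inr (Or.inr F.isTlc_refl)⟩
    · exact ⟨Or.inr (Or.inl h.of_conj.1), Or.inr (Or.inl h.of_conj.2)⟩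
    · exact ⟨Or.inr (Or.inr h.of_conj.1), Or.inr (Or.inr h.of_conj.2)⟩

theorem EL.subs_subset_of_mem {D : EL} : ∀ {C : EL}, D ∈ C.subs → D.subs ⊆ C.subs
  | .atom B, h => by
    cases (show D = .atom B from h)
    exact subset_rfl
  | .top, h => by
    cases (show D = .top from h)
    exact subset_rfl
  | .ex r C, h => by
    rcases h with h | h
    · rw [h]
    · exact fun _ hx => Or.inr (subs_subset_of_mem h hx)
  | .conj C₁ C₂, h => by
    rcases h with h | h | h
    · rw [h]
    · exact fun _ hx => Or.inr (Or.inl (subs_subset_of_mem h hx))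
    · exact fun _ hx => Or.inr (Or.inr (subs_subset_of_mem h hx))

theorem subs_subset_elSubsTC {T : ELTBox} {C D : EL} (h : D ∈ elSubsTC T C) :
    D.subs ⊆ elSubsTC T C := by
  intro x hx
  rcases h with ⟨p, hp, h | h⟩ | h
  · exact Or.inl ⟨p, hp, Or.inl (EL.subs_subset_of_mem h hx)⟩
  · exact Or.inl ⟨p, hp, Or.inr (EL.subs_subset_of_mem h hx)⟩
  · exact Or.inr (EL.subs_subset_of_mem h hx)

theorem canDom_subset_elSubsTC (T : ELTBox) (C : EL) : canDom T C ⊆ elSubsTC T C := by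
  rintro D (rfl | ⟨r, h⟩)
  · exact Or.inr D.mem_subs_self
  · exact subs_subset_elSubsTC h (Or.inr D.mem_subs_self)

theorem EL.isTlc.semE_subset {E : EL} (I : Interp) :
    ∀ {D : EL}, E.isTlc D → I.semE D ⊆ I.semE E
  | .atom B, h => by
    cases (show E = .atom B by simpa [EL.isTlc] using h)
    exact subset_rfl
  | .top, h => by
    cases (show E = .top by simpa [EL.isTlc] using h)
    exact subset_rfl
  | .ex r D, h => by
    rw [show E = .ex r D by simpa [EL.isTlc] using h]
  | .conj D₁ D₂, h => by
    rcases h with h | h | h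
    · rw [h]
    · exact fun _ hx => h.semE_subset I hx.1
    · exact fun _ hx => h.semE_subset I hx.2

theorem mem_semE_of_isTlc {T : ELTBox} {C : EL} (E : EL) :
    ∀ d : (canModel T C).Dom, E.isTlc d.1 → d ∈ (canModel T C).semE E := by
  induction E with
  | atom B => exact fun _ h I _ => h.semE_subset I
  | top => exact fun _ _ => trivial
  | conj E F ihE ihF => exact fun d h => ⟨ihE d h.of_conj.1, ihF d h.of_conj.2⟩
  | ex r E ih =>
    intro d h
    have hE : E ∈ canDom T C :=
      Or.inr ⟨r, subs_subset_elSubsTC (canDom_subset_elSubsTC T C d.2) h.mem_subs⟩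
    exact ⟨⟨E, hE⟩, ⟨fun I _ => h.semE_subset I, Or.inr h⟩, ih _ E.isTlc_refl⟩

theorem elEnt_of_mem_semE {T : ELTBox} {C : EL} (E : EL) :
    ∀ d : (canModel T C).Dom, d ∈ (canModel T C).semE E → elEnt T d.1 E := by
  induction E with
  | atom B => exact fun _ h => h
  | top => exact fun _ _ _ _ _ _ => trivial
  | conj E F ihE ihF => exact fun d h I hI x hx => ⟨ihE d h.1 I hI hx, ihF d h.2 I hI hx⟩
  | ex r E ih =>
    rintro d ⟨e, hde, he⟩ I hI x hx
    obtain ⟨y, hxy, hy⟩ := hde.1 I hI hx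
    exact ⟨y, hxy, ih e he I hI hy⟩

theorem mem_semE_of_elEnt_of_subs {T : ELTBox} {C : EL} (F : EL) (hF : F.subs ⊆ elSubsT T)
    (d : (canModel T C).Dom) (h : elEnt T d.1 F) : d ∈ (canModel T C).semE F := by
  induction F with
  | atom B => exact h
  | top => trivial
  | conj E F ihE ihF =>
    exact ⟨ihE (fun _ hx => hF (Or.inr (Or.inl hx))) fun I hI x hx => (h I hI hx).1,
      ihF (fun _ hx => hF (Or.inr (Or.inr hx))) fun I hI x hx => (h I hI hx).2⟩
  | ex r E _ =>
    have hE : EL.ex r E ∈ elSubsT T := hF (EL.mem_subs_self _)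
    exact ⟨⟨E, Or.inr ⟨r, Or.inl hE⟩⟩, ⟨h, Or.inl hE⟩, mem_semE_of_isTlc E _ E.isTlc_refl⟩

theorem canModel_modelEL (T : ELTBox) (C : EL) : (canModel T C).modelEL T := by
  intro p hp d hd
  refine mem_semE_of_elEnt_of_subs p.2 (fun _ hx => ⟨p, hp, Or.inr hx⟩) d ?_
  exact fun I hI x hx => hI p hp (elEnt_of_mem_semE p.1 d hd I hI hx)

/-- The finite canonical model `I_{T,C}` is a model of `T`,
and for all `D₀ ∈ sub(T, C)` with `a_{D₀} ∈ Δ^{I_{T,C}}` and all EL concepts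
`D₁`:  `T ⊨ D₀ ⊑ D₁` iff `a_{D₀} ∈ D₁^{I_{T,C}}`. -/
theorem statement_11 (T : ELTBox) (C : EL) :
    (canModel T C).modelEL T ∧
    ∀ (D₀ : EL) (h₀ : D₀ ∈ elSubsTC T C) (hdom : D₀ ∈ canDom T C) (D₁ : EL),
      elEnt T D₀ D₁ ↔ (⟨D₀, hdom⟩ : (canModel T C).Dom) ∈ (canModel T C).semE D₁ := by
  refine ⟨canModel_modelEL T C, fun D₀ _ hdom D₁ => ⟨fun h => ?_, elEnt_of_mem_semE D₁ _⟩⟩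
  exact h _ (canModel_modelEL T C) (mem_semE_of_isTlc D₀ _ D₀.isTlc_refl)

end DL
end

section
/- Let T be an EL TBox, C an EL concept, A a finite ABox, and a ∈ Ind(A). Then A ⊨ (T, ∅, q_C)(a) iff there exists m ≥ 0 such that T ⊨ C_a^m ⊑ C, where C_a^m is the depth-m unfolding of A at a. -/
namespace DL

/-- `d` satisfies the depth-`m` unfolding `C_a^m` of the ABox `A` at the
individual `a` in the interpretation `I` (this is exactly the semantics of the
EL concept `C_a^0 = ⊓_{B(a) ∈ A} B` and
`C_a^{m+1} = (⊓_{B(a) ∈ A} B) ⊓ (⊓_{r(a,b) ∈ A} ∃r.C_b^m)`). -/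
def unfSat (A : ABox) (I : Interp) : ℕ → ℕ → I.Dom → Prop
  | 0, a, d => ∀ B : ℕ, (B, a) ∈ A.ca → d ∈ I.cInt B
  | m + 1, a, d =>
      (∀ B : ℕ, (B, a) ∈ A.ca → d ∈ I.cInt B) ∧
      (∀ r b : ℕ, (r, a, b) ∈ A.ra → ∃ e, (d, e) ∈ I.rInt r ∧ unfSat A I m b e)

/-- `T ⊨ C_a^m ⊑ C`. -/
def unfEnt (T : ELTBox) (A : ABox) (a : ℕ) (m : ℕ) (C : EL) : Prop :=
  ∀ I : Interp, I.modelEL T → ∀ d : I.Dom, unfSat A I m a d → d ∈ I.semE C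

theorem unfSat_of_unfSat_succ (A : ABox) (I : Interp) (m : ℕ) :
    ∀ (a : ℕ) (d : I.Dom), unfSat A I (m + 1) a d → unfSat A I m a d := by
  induction m with
  | zero => exact fun a d h => h.1
  | succ m ih =>
    refine fun a d h => ⟨h.1, fun r b hr => ?_⟩
    obtain ⟨e, he, hs⟩ := h.2 r b hr
    exact ⟨e, he, ih b e hs⟩

theorem unfSat_antitone (A : ABox) (I : Interp) (a : ℕ) (d : I.Dom) :
    Antitone fun m => unfSat A I m a d :=
  antitone_nat_of_succ_le fun m => unfSat_of_unfSat_succ A I m a d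

theorem unfEnt.mono {T : ELTBox} {A : ABox} {a m n : ℕ} {C : EL} (hmn : m ≤ n)
    (h : unfEnt T A a m C) : unfEnt T A a n C :=
  fun I hI d hd => h I hI d (unfSat_antitone A I a d hmn hd)

theorem unfSat_of_modelA {A : ABox} {I : Interp} (hI : I.modelA A) (m : ℕ) :
    ∀ (a : ℕ) (d : I.Dom), I.ind a = some d → unfSat A I m a d := by
  have hc : ∀ (a : ℕ) (d : I.Dom), I.ind a = some d →
      ∀ B : ℕ, (B, a) ∈ A.ca → d ∈ I.cInt B := by
    intro a d had B hB
    obtain ⟨d', had', hd'⟩ := hI.1 _ hB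
    obtain rfl : d = d' := Option.some.inj (had.symm.trans had')
    exact hd'
  induction m with
  | zero => exact hc
  | succ m ih =>
    refine fun a d had => ⟨hc a d had, fun r b hr => ?_⟩
    obtain ⟨d', e, had', hbe, hde⟩ := hI.2 _ hr
    obtain rfl : d = d' := Option.some.inj (had.symm.trans had')
    exact ⟨e, hde, ih b e hbe⟩

/-- The concepts that the canonical model makes true at an element: an individual name
satisfies what `T` derives from one of its unfoldings, a concept what it entails. -/
def canonType (T : ELTBox) (A : ABox) : ℕ ⊕ EL → Set EL
  | .inl a => {D | ∃ m, unfEnt T A a m D}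
  | .inr E => {D | elEnt T E D}

/-- The canonical model of `T` and `A`, with the individual names and all EL concepts
as elements. -/
def canonModel (T : ELTBox) (A : ABox) : Interp where
  Dom := ℕ ⊕ EL
  dne := ⟨.inl 0⟩
  ind a := some (.inl a)
  ind_inj _ _ _ ha hb := Sum.inl.inj (Option.some.inj (ha.trans hb.symm))
  cInt B := {x | .atom B ∈ canonType T A x}
  rInt r := {p | (∃ a b, p = (.inl a, .inl b) ∧ (r, a, b) ∈ A.ra) ∨
    ∃ E, p.2 = .inr E ∧ .ex r E ∈ canonType T A p.1}

section canonType

variable {T : ELTBox} {A : ABox}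

theorem mem_canonType_of_entails {x : ℕ ⊕ EL} {D E : EL} (hD : D ∈ canonType T A x)
    (h : ∀ I : Interp, I.modelEL T → I.semE D ⊆ I.semE E) : E ∈ canonType T A x := by
  cases x with
  | inl a =>
    obtain ⟨m, hm⟩ := hD
    exact ⟨m, fun I hI d hd => h I hI (hm I hI d hd)⟩
  | inr F => exact fun I hI d hd => h I hI (hD I hI hd)

theorem top_mem_canonType (x : ℕ ⊕ EL) : EL.top ∈ canonType T A x := by
  cases x with
  | inl a => exact ⟨0, fun _ _ _ _ => trivial⟩
  | inr F => exact fun _ _ _ _ => trivial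

theorem conj_mem_canonType {x : ℕ ⊕ EL} {D E : EL} :
    EL.conj D E ∈ canonType T A x ↔ D ∈ canonType T A x ∧ E ∈ canonType T A x := by
  refine ⟨fun h => ⟨mem_canonType_of_entails h fun _ _ _ hd => hd.1,
    mem_canonType_of_entails h fun _ _ _ hd => hd.2⟩, fun ⟨hD, hE⟩ => ?_⟩
  cases x with
  | inl a =>
    obtain ⟨m, hm⟩ := hD
    obtain ⟨n, hn⟩ := hE
    exact ⟨max m n, fun I hI d hd => ⟨hm.mono (le_max_left m n) I hI d hd,
      hn.mono (le_max_right m n) I hI d hd⟩⟩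
  | inr F => exact fun I hI d hd => ⟨hD I hI hd, hE I hI hd⟩

theorem ex_mem_canonType {x : ℕ ⊕ EL} {r : ℕ} {D : EL} :
    EL.ex r D ∈ canonType T A x ↔
      ∃ y, (x, y) ∈ (canonModel T A).rInt r ∧ D ∈ canonType T A y := by
  constructor
  · exact fun h => ⟨.inr D, .inr ⟨D, rfl, h⟩, fun _ _ _ hd => hd⟩
  · rintro ⟨y, ⟨a, b, hxy, hr⟩ | ⟨E, rfl, hE⟩, hD⟩
    · obtain ⟨rfl, rfl⟩ := Prod.mk.inj hxy
      obtain ⟨m, hm⟩ := hD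
      refine ⟨m + 1, fun I hI d hd => ?_⟩
      obtain ⟨e, hde, he⟩ := hd.2 r b hr
      exact ⟨e, hde, hm I hI e he⟩
    · exact mem_canonType_of_entails hE fun I hI _ ⟨e, hde, he⟩ => ⟨e, hde, hD I hI he⟩

theorem mem_semE_canonModel_iff (D : EL) :
    ∀ x : ℕ ⊕ EL, x ∈ (canonModel T A).semE D ↔ D ∈ canonType T A x := by
  induction D with
  | atom B => exact fun _ => Iff.rfl
  | top => exact fun x => iff_of_true trivial (top_mem_canonType x)
  | conj D E ihD ihE =>
    exact fun x => (and_congr (ihD x) (ihE x)).trans conj_mem_canonType.symm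
  | ex r D ih =>
    exact fun x => (exists_congr fun y => and_congr_right fun _ => ih y).trans
      ex_mem_canonType.symm

theorem canonModel_modelEL : (canonModel T A).modelEL T := fun p hp x hx =>
  (mem_semE_canonModel_iff p.2 x).2 <|
    mem_canonType_of_entails ((mem_semE_canonModel_iff p.1 x).1 hx) fun _ hI => hI p hp

theorem canonModel_modelA : (canonModel T A).modelA A :=
  ⟨fun p hp => ⟨.inl p.2, rfl, 0, fun _ _ _ hd => hd p.1 hp⟩,
    fun t ht => ⟨.inl t.2.1, .inl t.2.2, rfl, rfl, .inl ⟨t.2.1, t.2.2, rfl, ht⟩⟩⟩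

end canonType

/-- For every EL TBox `T`, EL concept `C`, finite ABox `A`
and `a ∈ Ind(A)`:  `A ⊨ (T, ∅, q_C)(a)` iff there is some `m ≥ 0` with
`T ⊨ C_a^m ⊑ C`, where `C_a^m` is the depth-`m` unfolding of `A` at `a`. -/
theorem statement_14 (T : ELTBox) (C : EL) (A : ABox) (hA : A.Fin)
    (a : ℕ) (ha : a ∈ A.ind) :
    (∀ I : Interp, I.modelEL T → I.modelA A →
        ∀ d : I.Dom, I.ind a = some d → d ∈ I.semE C) ↔
    (∃ m : ℕ, unfEnt T A a m C) := by
  constructor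
  · intro h
    exact (mem_semE_canonModel_iff C (.inl a)).1
      (h (canonModel T A) canonModel_modelEL canonModel_modelA (.inl a) rfl)
  · rintro ⟨m, hm⟩ I hT hI d had
    exact hm I hT d (unfSat_of_modelA hI m a d had)

end DL
end

section
/- For every EL TBox T there exists an EL TBox T* that is equivalent to T (T and T* have the same models) and reduced, i.e.: (red1) T* contains no concept inclusion of the form C ⊑ D₁ ⊓ D₂; (red2) if C ⊑ ∃r.D ∈ T*, then there is no top-level conjunct ∃r.C' of C with T* ⊨ C' ⊑ D. -/
namespace DL

/-- An EL TBox is reduced if (red1) it contains no concept inclusion whose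
right-hand side is a conjunction and (red2) for no `C ⊑ ∃r.D` in it there is a
top-level conjunct `∃r.C'` of `C` with `T ⊨ C' ⊑ D`. -/
def ELReduced (T : ELTBox) : Prop :=
  (∀ C D₁ D₂ : EL, (C, EL.conj D₁ D₂) ∉ T) ∧
  (∀ (C : EL) (r : ℕ) (D : EL), (C, EL.ex r D) ∈ T →
    ¬ ∃ C' : EL, EL.isTlc (.ex r C') C ∧ elEnt T C' D)

theorem semE_subset_of_isTlc (I : Interp) {E C : EL} (h : E.isTlc C) :
    I.semE C ⊆ I.semE E := by
  induction C with
  | atom B => simp only [EL.isTlc] at h; rw [h]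
  | top => simp only [EL.isTlc] at h; rw [h]
  | ex r C _ => simp only [EL.isTlc] at h; rw [h]
  | conj C D ihC ihD =>
    simp only [EL.isTlc] at h
    rcases h with h | h | h
    · rw [h]
    · exact Set.inter_subset_left.trans (ihC h)
    · exact Set.inter_subset_right.trans (ihD h)

/-- The concept inclusion `p` follows from `T` and satisfies (red1) and (red2), where the
entailment in (red2) is with respect to `T`. -/
def IsReducedConsequence (T : ELTBox) (p : EL × EL) : Prop :=
  elEnt T p.1 p.2 ∧ (∀ D₁ D₂, p.2 ≠ .conj D₁ D₂) ∧
    ∀ r D, p.2 = .ex r D → ¬ ∃ C', EL.isTlc (.ex r C') p.1 ∧ elEnt T C' D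

/-- Every consequence of `T` follows from finitely many reduced consequences of `T`. -/
theorem exists_reducedConsequences (T : ELTBox) (D : EL) :
    ∀ C, elEnt T C D →
      ∃ L : ELTBox, (∀ p ∈ L, IsReducedConsequence T p) ∧ elEnt L C D := by
  induction D with
  | atom B =>
    intro C h
    exact ⟨[(C, .atom B)], by simp [IsReducedConsequence, h], fun I hI => hI _ List.mem_cons_self⟩
  | top =>
    intro C h
    exact ⟨[], by simp, fun I _ => Set.subset_univ _⟩
  | conj D₁ D₂ ih₁ ih₂ =>
    intro C h
    obtain ⟨L₁, hr₁, he₁⟩ := ih₁ C fun I hI => (h I hI).trans Set.inter_subset_left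
    obtain ⟨L₂, hr₂, he₂⟩ := ih₂ C fun I hI => (h I hI).trans Set.inter_subset_right
    refine ⟨L₁ ++ L₂, fun p hp => (List.mem_append.1 hp).elim (hr₁ p) (hr₂ p), fun I hI => ?_⟩
    exact Set.subset_inter
      (he₁ I fun p hp => hI p (List.mem_append_left _ hp))
      (he₂ I fun p hp => hI p (List.mem_append_right _ hp))
  | ex r D ih =>
    intro C h
    by_cases hC : ∃ C', EL.isTlc (.ex r C') C ∧ elEnt T C' D
    · obtain ⟨C', htlc, hent⟩ := hC
      obtain ⟨L, hr, he⟩ := ih C' hent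
      refine ⟨L, hr, fun I hI => (semE_subset_of_isTlc I htlc).trans ?_⟩
      rintro d ⟨e, hde, heC⟩
      exact ⟨e, hde, he I hI heC⟩
    · refine ⟨[(C, .ex r D)], ?_, fun I hI => hI _ List.mem_cons_self⟩
      simp only [List.mem_singleton, forall_eq]
      refine ⟨h, by simp, fun r' D' heq => ?_⟩
      cases heq
      exact hC

/-- For every EL TBox `T` there is an equivalent reduced EL
TBox `T*` (equivalent: `T` and `T*` have the same models). -/
theorem statement_16 (T : ELTBox) :
    ∃ Tstar : ELTBox,
      (∀ I : Interp, I.modelEL T ↔ I.modelEL Tstar) ∧ ELReduced Tstar := by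
  have hself : ∀ p ∈ T, elEnt T p.1 p.2 := fun p hp I hI => hI p hp
  choose! f hf hent using fun p (hp : p ∈ T) =>
    exists_reducedConsequences T p.2 p.1 (hself p hp)
  have hred : ∀ p ∈ T.flatMap f, IsReducedConsequence T p := by
    intro p hp
    obtain ⟨q, hq, hpq⟩ := List.mem_flatMap.1 hp
    exact hf q hq p hpq
  have hequiv : ∀ I : Interp, I.modelEL T ↔ I.modelEL (T.flatMap f) := fun I =>
    ⟨fun hI p hp => (hred p hp).1 I hI, fun hI p hp =>
      hent p hp I fun q hq => hI q (List.mem_flatMap.2 ⟨p, hp, hq⟩)⟩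
  refine ⟨T.flatMap f, hequiv, fun C D₁ D₂ hp => (hred _ hp).2.1 D₁ D₂ rfl, ?_⟩
  rintro C r D hp ⟨C', htlc, hC'⟩
  exact (hred _ hp).2.2 r D rfl ⟨C', htlc, fun I hI => hC' I ((hequiv I).1 hI)⟩

end DL
end

section
/- Let T be a reduced EL TBox and Σ_C a signature. Then (T, Σ_C) is safe if and only if (T, Σ_C) is strongly safe. -/
namespace DL

/-- Safeness of an EL TBox with closed predicates `(T, S_C)`, where `S_C`
consists of the concept names `Sc` and the role names `Sr`. -/
def ELSafe (T : ELTBox) (Sc Sr : Set ℕ) : Prop :=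
  ¬ ∃ (C : EL) (r : ℕ) (D : EL),
      -- (1)
      elEnt T C (.ex r D) ∧
      -- (2)
      (¬ ∃ C' : EL, EL.isTlc (.ex r C') C ∧ elEnt T C' D) ∧
      -- (3)
      ( -- (s1)
        (r ∉ Sr ∧ ((D.sigC ∩ Sc).Nonempty ∨ (D.sigR ∩ Sr).Nonempty)) ∨
        -- (s2)
        (r ∈ Sr ∧ ¬ (D.sigC ⊆ Sc ∧ D.sigR ⊆ Sr) ∧
          ¬ ∃ E : EL, E.sigC ⊆ Sc ∧ E.sigR ⊆ Sr ∧ elEnt T C (.ex r E) ∧ elEnt T E D) )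

/-- Strong safeness of an EL TBox with closed predicates `(T, S_C)`: no concept
inclusion `C ⊑ ∃r.D` *contained in* `T` satisfies (st1) or (st2). -/
def ELStronglySafe (T : ELTBox) (Sc Sr : Set ℕ) : Prop :=
  ¬ ∃ (C : EL) (r : ℕ) (D : EL), (C, EL.ex r D) ∈ T ∧
      ( -- (st1)
        (r ∉ Sr ∧ ∃ E : EL, elEnt T D E ∧
          ((E.sigC ∩ Sc).Nonempty ∨ (E.sigR ∩ Sr).Nonempty)) ∨
        -- (st2)
        (r ∈ Sr ∧ ¬ (D.sigC ⊆ Sc ∧ D.sigR ⊆ Sr) ∧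
          ¬ ∃ E : EL, E.sigC ⊆ Sc ∧ E.sigR ⊆ Sr ∧ elEnt T C (.ex r E) ∧ elEnt T E D) )

theorem elEnt.trans {T : ELTBox} {C D E : EL} (h : elEnt T C D) (h' : elEnt T D E) :
    elEnt T C E :=
  fun I hI _ hd => h' I hI (h I hI hd)

theorem elEnt.ex_mono {T : ELTBox} {C D : EL} (r : ℕ) (h : elEnt T C D) :
    elEnt T (.ex r C) (.ex r D) :=
  fun I hI _ ⟨e, hr, he⟩ => ⟨e, hr, h I hI he⟩

theorem elEnt_of_mem {T : ELTBox} {C D : EL} (h : (C, D) ∈ T) : elEnt T C D :=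
  fun _ hI => hI _ h

theorem EL.isTlc_of_conj {D E C : EL} (h : (EL.conj D E).isTlc C) :
    D.isTlc C ∧ E.isTlc C := by
  induction C with
  | conj C₁ C₂ ih₁ ih₂ =>
    rcases h with h | h | h
    · obtain ⟨rfl, rfl⟩ := EL.conj.inj h
      exact ⟨Or.inr (Or.inl D.isTlc_refl), Or.inr (Or.inr E.isTlc_refl)⟩
    · exact ⟨Or.inr (Or.inl (ih₁ h).1), Or.inr (Or.inl (ih₁ h).2)⟩
    · exact ⟨Or.inr (Or.inr (ih₂ h).1), Or.inr (Or.inr (ih₂ h).2)⟩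
  | _ => simp [EL.isTlc] at h

theorem EL.isTlc.elEnt {D C : EL} (T : ELTBox) (h : D.isTlc C) : elEnt T C D := by
  induction C with
  | conj C₁ C₂ ih₁ ih₂ =>
    rcases h with rfl | h | h
    · exact fun _ _ _ hd => hd
    · exact fun I hI _ hd => ih₁ h I hI hd.1
    · exact fun I hI _ hd => ih₂ h I hI hd.2
  | _ =>
    simp only [EL.isTlc] at h
    subst h
    exact fun _ _ _ hd => hd

/-- The canonical interpretation of an EL TBox: its elements are the EL concepts, and `C` has
an `r`-successor `D` if `∃r.D` is a top-level conjunct of `C` or the right-hand side of an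
inclusion in `T` whose left-hand side subsumes `C`. -/
def canonicalInterp (T : ELTBox) : Interp where
  Dom := EL
  dne := ⟨.top⟩
  ind := fun _ => none
  ind_inj := by simp
  cInt := fun B => {C | elEnt T C (.atom B)}
  rInt := fun r => {p | (EL.ex r p.2).isTlc p.1 ∨ ∃ C₀, (C₀, EL.ex r p.2) ∈ T ∧ elEnt T p.1 C₀}

theorem elEnt_of_mem_canonicalInterp {T : ELTBox} {C D : EL}
    (h : C ∈ (canonicalInterp T).semE D) : elEnt T C D := by
  induction D generalizing C with
  | atom B => exact h
  | top => exact fun _ _ _ _ => trivial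
  | conj D E ihD ihE => exact fun I hI _ hd => ⟨ihD h.1 I hI hd, ihE h.2 I hI hd⟩
  | ex r D ih =>
    obtain ⟨E, hr, hE⟩ := h
    refine elEnt.trans ?_ (elEnt.ex_mono r (ih hE))
    rcases hr with hr | ⟨C₀, hmem, hC⟩
    · exact hr.elEnt T
    · exact hC.trans (elEnt_of_mem hmem)

theorem EL.isTlc.mem_canonicalInterp {T : ELTBox} {C D : EL} (h : D.isTlc C) :
    C ∈ (canonicalInterp T).semE D := by
  induction D generalizing C with
  | atom B => exact h.elEnt T
  | top => trivial
  | conj D E ihD ihE =>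
    exact ⟨ihD (EL.isTlc_of_conj h).1, ihE (EL.isTlc_of_conj h).2⟩
  | ex r D ih => exact ⟨D, Or.inl h, ih D.isTlc_refl⟩

theorem canonicalInterp_modelEL {T : ELTBox}
    (hT : ∀ C D₁ D₂ : EL, (C, EL.conj D₁ D₂) ∉ T) : (canonicalInterp T).modelEL T := by
  rintro ⟨C₀, D⟩ hmem C hC
  replace hC : elEnt T C C₀ := elEnt_of_mem_canonicalInterp hC
  cases D with
  | atom B => exact hC.trans (elEnt_of_mem hmem)
  | top => trivial
  | conj D₁ D₂ => exact absurd hmem (hT _ _ _)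
  | ex r D => exact ⟨D, Or.inr ⟨C₀, hmem, hC⟩, D.isTlc_refl.mem_canonicalInterp⟩

/-- An existential restriction entailed by `C` stems from a top-level conjunct of `C` or from
the right-hand side of an inclusion in `T`. -/
theorem elEnt_ex_cases {T : ELTBox} (hT : ∀ C D₁ D₂ : EL, (C, EL.conj D₁ D₂) ∉ T)
    {C D : EL} {r : ℕ} (h : elEnt T C (.ex r D)) :
    (∃ C', (EL.ex r C').isTlc C ∧ elEnt T C' D) ∨
      ∃ C₀ D₀, (C₀, EL.ex r D₀) ∈ T ∧ elEnt T C C₀ ∧ elEnt T D₀ D := by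
  obtain ⟨E, hr, hE⟩ := h _ (canonicalInterp_modelEL hT) C.isTlc_refl.mem_canonicalInterp
  replace hE : elEnt T E D := elEnt_of_mem_canonicalInterp hE
  rcases hr with hr | ⟨C₀, hmem, hC⟩
  · exact Or.inl ⟨E, hr, hE⟩
  · exact Or.inr ⟨C₀, E, hmem, hC, hE⟩

/-- Let `T` be a reduced EL TBox and `S_C` a signature
(closed concept names `Sc` and closed role names `Sr`).  Then `(T, S_C)` is safe
iff it is strongly safe. -/
theorem statement_17 (T : ELTBox) (Sc Sr : Set ℕ)
    (hfin : Sc.Finite ∧ Sr.Finite) (hred : ELReduced T) :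
    ELSafe T Sc Sr ↔ ELStronglySafe T Sc Sr := by
  constructor
  · rintro hsafe ⟨C, r, D, hmem, ⟨hr, E, hDE, hE⟩ | hst2⟩
    · have hD : elEnt T D (.conj D E) := fun I hI _ hd => ⟨hd, hDE I hI hd⟩
      refine hsafe ⟨C, r, .conj D E, (elEnt_of_mem hmem).trans (hD.ex_mono r), ?_,
        Or.inl ⟨hr, ?_⟩⟩
      · rintro ⟨C', htlc, hC'⟩
        exact hred.2 C r D hmem ⟨C', htlc, fun I hI _ hd => (hC' I hI hd).1⟩
      · exact hE.imp (fun h => h.mono (Set.inter_subset_inter_left _ Set.subset_union_right))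
          (fun h => h.mono (Set.inter_subset_inter_left _ Set.subset_union_right))
    · exact hsafe ⟨C, r, D, elEnt_of_mem hmem, hred.2 C r D hmem, Or.inr hst2⟩
  · rintro hstrong ⟨C, r, D, hent, htlc, hs⟩
    obtain ⟨C₀, D₀, hmem, hC, hD⟩ := (elEnt_ex_cases hred.1 hent).resolve_left htlc
    refine hstrong ⟨C₀, r, D₀, hmem, ?_⟩
    rcases hs with ⟨hr, hsig⟩ | ⟨hr, -, hE⟩
    · exact Or.inl ⟨hr, D, hD, hsig⟩
    · refine Or.inr ⟨hr, fun hsig => hE ?_, ?_⟩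
      · exact ⟨D₀, hsig.1, hsig.2, hC.trans (elEnt_of_mem hmem), hD⟩
      · rintro ⟨E, hEc, hEr, hCE, hED⟩
        exact hE ⟨E, hEc, hEr, hC.trans hCE, hED.trans hD⟩

end DL
end
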